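/- arXiv:0805.2421 — 2 statements merged into one kernel-verified Lean document; each statement's English description precedes it below -/
import Mathlib

section
/- Let Ψ be a symmetric malicious Bayesian congestion game with singleton strategy sets, identical type probability p with 1/2 < p < 1, and identical affine latency functions f(x) = a·x + b with a > 0 and b ≥ 0, with n ≥ 2 players and exactly r = 2 resources. Then Ψ possesses no pure Bayesian Nash equilibrium. -/
open Finset

/-- The data of a malicious Bayesian congestion game: strategy sets (sets of
nonempty subsets of resources), type probabilities, latency functions. -/
structure Game (N E : Type) where
  S : N → Finset (Finset E)
  p : N → ℝ
  f : E → ℝ → ℝ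

namespace Game

variable {N E : Type} [Fintype N] [DecidableEq N] [Fintype E] [DecidableEq E]

/-- A pure strategy profile: each player chooses a pair (selfish strategy, malicious strategy). -/
abbrev Profile (N E : Type) := N → Finset E × Finset E

/-- Validity: both type-agents of each player choose strategies from the player's strategy set. -/
def Valid (G : Game N E) (σ : Profile N E) : Prop :=
  ∀ u, (σ u).1 ∈ G.S u ∧ (σ u).2 ∈ G.S u

/-- Expected selfish load on resource `e`, with player `u` omitted. -/
noncomputable def selfLoadEx (G : Game N E) (σ : Profile N E) (u : N) (e : E) : ℝ :=
  ∑ v ∈ Finset.univ.erase u, if e ∈ (σ v).1 then 1 - G.p v else 0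

/-- Expected malicious load on resource `e`, with player `u` omitted. -/
noncomputable def malLoadEx (G : Game N E) (σ : Profile N E) (u : N) (e : E) : ℝ :=
  ∑ v ∈ Finset.univ.erase u, if e ∈ (σ v).2 then G.p v else 0

/-- Private (expected) cost of player `u` in the pure profile `σ`. -/
noncomputable def PC (G : Game N E) (σ : Profile N E) (u : N) : ℝ :=
  ∑ e ∈ (σ u).1, G.f e (G.selfLoadEx σ u e + G.malLoadEx σ u e + 1)

/-- Social cost of a pure profile: weighted average latency of the selfish type-agents. -/
noncomputable def SC (G : Game N E) (σ : Profile N E) : ℝ :=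
  (∑ u, (1 - G.p u) * G.PC σ u) / ((Fintype.card N : ℝ) - ∑ u, G.p u)

/-- Replace the selfish strategy of player `u` by `t`. -/
def updS (σ : Profile N E) (u : N) (t : Finset E) : Profile N E :=
  Function.update σ u (t, (σ u).2)

/-- Replace the malicious strategy of player `u` by `t`. -/
def updM (σ : Profile N E) (u : N) (t : Finset E) : Profile N E :=
  Function.update σ u ((σ u).1, t)

/-- Pure Bayesian Nash equilibrium: no selfish type-agent can decrease its private cost and
no malicious type-agent can increase the social cost by a unilateral deviation. -/
def IsPureBNE (G : Game N E) (σ : Profile N E) : Prop :=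
  G.Valid σ ∧ ∀ u : N, ∀ t ∈ G.S u,
    G.PC σ u ≤ G.PC (updS σ u t) u ∧ G.SC (updM σ u t) ≤ G.SC σ

end Game
/-- A symmetric malicious Bayesian congestion game with `n` players, `r` resources,
singleton strategy sets, identical type probability `p` and identical affine
latency functions `f(x) = a·x + b`. -/
noncomputable def SymGame (n r : ℕ) (p a b : ℝ) : Game (Fin n) (Fin r) where
  S := fun _ => Finset.univ.image fun e => ({e} : Finset (Fin r))
  p := fun _ => p
  f := fun _ x => a * x + b

namespace SymAux

/-- Sign encoding of the two resources. -/
def sg (e : Fin 2) : ℤ := if e = 0 then 1 else -1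

lemma sg_cases (e : Fin 2) : sg e = 1 ∨ sg e = -1 := by
  fin_cases e <;> simp [sg]

lemma sg_flip (e : Fin 2) : ∃ t, sg t = - sg e := by
  fin_cases e
  · exact ⟨1, by simp [sg]⟩
  · exact ⟨0, by simp [sg]⟩

lemma ite_sg (e s : Fin 2) (c : ℝ) :
    (if e ∈ ({s} : Finset (Fin 2)) then c else 0) = c * (1 + (sg e : ℝ) * sg s) / 2 := by
  fin_cases e <;> fin_cases s <;> simp [sg] <;> ring

/-- Combinatorial core. -/
lemma core (n : ℕ) (hn : 2 ≤ n) (p : ℝ) (hp0 : 1 / 2 < p) (hp1 : p < 1)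
    (x y : Fin n → ℤ) (hx : ∀ u, x u = 1 ∨ x u = -1) (hy : ∀ u, y u = 1 ∨ y u = -1)
    (hS : ∀ u, (x u : ℝ) * ((1 - p) * ((∑ v, x v : ℤ) - x u) + p * ((∑ v, y v : ℤ) - y u)) ≤ 0)
    (hM : ∀ u, 0 ≤ y u * (∑ v, x v - x u)) (hX : 0 ≤ ∑ v, x v) : False := by
  have hpar : (2 : ℤ) ∣ ∑ v, x v - ∑ v, y v := by
    rw [← Finset.sum_sub_distrib]
    apply Finset.dvd_sum
    intro u _
    rcases hx u with h | h <;> rcases hy u with h' | h' <;> rw [h, h'] <;> decide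
  have hally : (∀ u, y u = 1) → ∑ v, y v = (n : ℤ) := by
    intro h; simp [h]
  have hallx : (∀ u, x u = -1) → ∑ v, x v = -(n : ℤ) := by
    intro h; simp [h]
  have hallx1 : (∀ u, x u = 1) → ∑ v, x v = (n : ℤ) := by
    intro h; simp [h]
  have hyx : (∀ u, y u = - x u) → ∑ v, y v = - ∑ v, x v := by
    intro h; simp [h]
  generalize (∑ v, x v) = X at *
  generalize (∑ v, y v) = Y at *
  have hnR : (2 : ℝ) ≤ n := by exact_mod_cast hn
  rcases (by omega : X = 0 ∨ X = 1 ∨ 2 ≤ X) with h0 | h1 | h2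
  · subst h0
    have hY : Y = 0 := by
      have := hyx (by
        intro u
        have := hM u
        rcases hx u with h | h <;> rcases hy u with h' | h' <;> rw [h, h'] at this ⊢ <;> omega)
      omega
    subst hY
    have : ∃ u, x u = 1 := by
      by_contra hcon
      push Not at hcon
      have := hallx (fun u => (hx u).resolve_left (hcon u))
      omega
    obtain ⟨u, hu⟩ := this
    have hyu : y u = -1 := by
      have := hM u
      rcases hy u with h' | h' <;> rw [hu, h'] at this
      · omega
      · exact h'
    have := hS u
    rw [hu, hyu] at this
    push_cast at this
    linarith
  · subst h1
    have : ∃ u, x u = -1 := by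
      by_contra hcon
      push Not at hcon
      have := hallx1 (fun u => (hx u).resolve_right (hcon u))
      omega
    obtain ⟨w, hw⟩ := this
    have hmin : ∀ u, x u = -1 → y u = 1 := by
      intro u hu
      have := hM u
      rcases hy u with h' | h' <;> rw [hu, h'] at this
      · exact h'
      · omega
    have hY1 : 1 ≤ Y := by
      by_contra hcon
      have hYle : Y ≤ -1 := by omega
      have hYR : (Y : ℝ) ≤ -1 := by exact_mod_cast hYle
      have := hS w
      rw [hw, hmin w hw] at this
      push_cast at this
      nlinarith
    have hall : ∀ u, y u = 1 ∧ (x u = 1 → Y ≤ 1) := by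
      intro u
      rcases hx u with h | h
      · have := hS u
        rw [h] at this
        have h3 : (Y : ℝ) ≤ y u := by
          push_cast at this
          nlinarith
        have h4 : Y ≤ y u := by exact_mod_cast h3
        rcases hy u with h' | h' <;> omega
      · refine ⟨hmin u h, ?_⟩
        intro h'; omega
    have hYn := hally (fun u => (hall u).1)
    have : ∃ u, x u = 1 := by
      by_contra hcon
      push Not at hcon
      have := hallx (fun u => (hx u).resolve_left (hcon u))
      omega
    obtain ⟨u, hu⟩ := this
    have := (hall u).2 hu
    omega
  · have hy1 : ∀ u, y u = 1 := by
      intro u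
      have := hM u
      rcases hx u with h | h <;> rcases hy u with h' | h' <;> rw [h, h'] at this <;> omega
    have hYn := hally hy1
    have := hallx (by
      intro u
      rcases hx u with h | h
      · exfalso
        have := hS u
        rw [h, hy1 u, hYn] at this
        push_cast at this
        have hXR : (2 : ℝ) ≤ X := by exact_mod_cast h2
        nlinarith
      · exact h)
    omega

/-- The profile given by choice functions. -/
def prof {n : ℕ} (s m : Fin n → Fin 2) : Game.Profile (Fin n) (Fin 2) := fun u => ({s u}, {m u})

lemma updS_prof {n : ℕ} (s m : Fin n → Fin 2) (u : Fin n) (t : Fin 2) :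
    Game.updS (prof s m) u {t} = prof (Function.update s u t) m := by
  funext v
  by_cases h : v = u
  · subst h; simp [Game.updS, prof]
  · simp [Game.updS, prof, h]

lemma updM_prof {n : ℕ} (s m : Fin n → Fin 2) (u : Fin n) (t : Fin 2) :
    Game.updM (prof s m) u {t} = prof s (Function.update m u t) := by
  funext v
  by_cases h : v = u
  · subst h; simp [Game.updM, prof]
  · simp [Game.updM, prof, h]

lemma sum_upd {n : ℕ} (g : Fin n → ℝ) (m : Fin n → Fin 2) (u : Fin n) (t : Fin 2) :
    ∑ v, g v * (sg (Function.update m u t v) : ℝ)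
      = ∑ v, g v * (sg (m v) : ℝ) - g u * sg (m u) + g u * sg t := by
  rw [← Finset.add_sum_erase _ _ (Finset.mem_univ u),
    ← Finset.add_sum_erase _ (fun v => g v * (sg (m v) : ℝ)) (Finset.mem_univ u)]
  have : ∑ v ∈ Finset.univ.erase u, g v * (sg (Function.update m u t v) : ℝ)
      = ∑ v ∈ Finset.univ.erase u, g v * (sg (m v) : ℝ) := by
    apply Finset.sum_congr rfl
    intro v hv
    rw [Function.update_of_ne (Finset.ne_of_mem_erase hv)]
  rw [this]
  simp
  ring

lemma load {n : ℕ} (s : Fin n → Fin 2) (u : Fin n) (e : Fin 2) (c : ℝ) :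
    (∑ v ∈ Finset.univ.erase u, if e ∈ ({s v} : Finset (Fin 2)) then c else 0)
      = c * (((n : ℝ) - 1) + (sg e : ℝ) * (∑ v, (sg (s v) : ℝ) - sg (s u))) / 2 := by
  simp only [ite_sg]
  rw [Finset.sum_erase_eq_sub (Finset.mem_univ u), ← Finset.sum_div, ← Finset.mul_sum,
    Finset.sum_add_distrib, ← Finset.mul_sum]
  simp
  ring

lemma PC_prof {n : ℕ} (p a b : ℝ) (s m : Fin n → Fin 2) (u : Fin n) :
    (SymGame n 2 p a b).PC (prof s m) u
      = a * (((n : ℝ) - 1) / 2 + (sg (s u) : ℝ) *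
        ((1 - p) * (∑ v, (sg (s v) : ℝ) - sg (s u))
          + p * (∑ v, (sg (m v) : ℝ) - sg (m u))) / 2 + 1) + b := by
  have h : (SymGame n 2 p a b).PC (prof s m) u
      = a * ((∑ v ∈ Finset.univ.erase u, if s u ∈ ({s v} : Finset (Fin 2)) then 1 - p else 0)
        + (∑ v ∈ Finset.univ.erase u, if s u ∈ ({m v} : Finset (Fin 2)) then p else 0) + 1) + b := by
    simp only [Game.PC, prof, Finset.sum_singleton]
    rfl
  rw [h, load, load]
  ring

lemma SC_prof {n : ℕ} (p a b : ℝ) (s m : Fin n → Fin 2) :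
    (SymGame n 2 p a b).SC (prof s m)
      = ((1 - p) * (∑ u, (a * (((n : ℝ) - 1) / 2 + (sg (s u) : ℝ) *
          ((1 - p) * (∑ v, (sg (s v) : ℝ) - sg (s u))) / 2 + 1) + b)
        + a * p / 2 * ((∑ v, (sg (s v) : ℝ)) * (∑ v, (sg (m v) : ℝ))
          - ∑ v, (sg (s v) : ℝ) * sg (m v)))) / ((n : ℝ) * (1 - p)) := by
  have h : (SymGame n 2 p a b).SC (prof s m)
      = (∑ u, (1 - p) * (SymGame n 2 p a b).PC (prof s m) u) / ((n : ℝ) * (1 - p)) := by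
    have h2 : ((Fintype.card (Fin n) : ℝ) - ∑ _u : Fin n, p) = (n : ℝ) * (1 - p) := by
      simp; ring
    rw [← h2]; rfl
  rw [h, ← Finset.mul_sum]
  congr 2
  rw [Finset.sum_mul, ← Finset.sum_sub_distrib, Finset.mul_sum, ← Finset.sum_add_distrib]
  apply Finset.sum_congr rfl
  intro u _
  rw [PC_prof]
  ring

end SymAux

open SymAux in
theorem symGame_no_pure_BNE_of_two_resources (n : ℕ) (hn : 2 ≤ n)
    (p a b : ℝ) (hp0 : 1 / 2 < p) (hp1 : p < 1) (ha : 0 < a) (hb : 0 ≤ b) :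
    ¬ ∃ σ : Game.Profile (Fin n) (Fin 2), (SymGame n 2 p a b).IsPureBNE σ := by
  rintro ⟨σ, hv, heq⟩
  have hex : ∀ u, ∃ q : Fin 2 × Fin 2, σ u = ({q.1}, {q.2}) := by
    intro u
    obtain ⟨h1, h2⟩ := hv u
    simp only [SymGame, Finset.mem_image, Finset.mem_univ, true_and] at h1 h2
    obtain ⟨e, he⟩ := h1
    obtain ⟨e', he'⟩ := h2
    exact ⟨(e, e'), Prod.ext he.symm he'.symm⟩
  choose q hq using hex
  obtain ⟨s, hs⟩ : ∃ s : Fin n → Fin 2, s = fun u => (q u).1 := ⟨_, rfl⟩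
  obtain ⟨m, hm⟩ : ∃ m : Fin n → Fin 2, m = fun u => (q u).2 := ⟨_, rfl⟩
  have hσ : σ = prof s m := by
    funext u
    rw [hq u, hs, hm]; rfl
  subst hσ
  have hmem : ∀ (u : Fin n) (t : Fin 2), ({t} : Finset (Fin 2)) ∈ (SymGame n 2 p a b).S u := by
    intro u t
    simp [SymGame]
  have hS : ∀ u, (sg (s u) : ℝ) * ((1 - p) * ((∑ v, sg (s v) : ℤ) - sg (s u))
      + p * ((∑ v, sg (m v) : ℤ) - sg (m u))) ≤ 0 := by
    intro u
    obtain ⟨t, ht⟩ := sg_flip (s u)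
    have h := (heq u {t} (hmem u t)).1
    rw [updS_prof, PC_prof, PC_prof] at h
    have hu := sum_upd (fun _ => 1) s u t
    simp only [one_mul] at hu
    rw [hu, Function.update_self, ht] at h
    push_cast at h ⊢
    have h' := le_of_mul_le_mul_left (le_of_add_le_add_right h) ha
    linarith
  have hM : ∀ u, 0 ≤ sg (m u) * (∑ v, sg (s v) - sg (s u)) := by
    intro u
    obtain ⟨t, ht⟩ := sg_flip (m u)
    have h := (heq u {t} (hmem u t)).2
    rw [updM_prof, SC_prof, SC_prof] at h
    have hu := sum_upd (fun _ => 1) m u t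
    have hu2 := sum_upd (fun v => (sg (s v) : ℝ)) m u t
    simp only [one_mul] at hu
    rw [hu, hu2, ht] at h
    have hnR : (2 : ℝ) ≤ n := by exact_mod_cast hn
    have hq0 : 0 < 1 - p := by linarith
    have hden : 0 < (n : ℝ) * (1 - p) := by positivity
    rw [div_le_div_iff_of_pos_right hden] at h
    have h1 := le_of_add_le_add_left (le_of_mul_le_mul_left h hq0)
    have hap : 0 < a * p / 2 := by positivity
    have h2 := le_of_mul_le_mul_left h1 hap
    push_cast at h2
    have h3 : (0 : ℝ) ≤ sg (m u) * (∑ v, (sg (s v) : ℝ) - sg (s u)) := by linarith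
    exact_mod_cast h3
  rcases le_total 0 (∑ v, sg (s v)) with hX | hX
  · exact core n hn p hp0 hp1 (fun u => sg (s u)) (fun u => sg (m u))
      (fun u => sg_cases _) (fun u => sg_cases _) hS hM hX
  · refine core n hn p hp0 hp1 (fun u => - sg (s u)) (fun u => - sg (m u))
      (fun u => ?_) (fun u => ?_) (fun u => ?_) (fun u => ?_) ?_
    · have := sg_cases (s u); omega
    · have := sg_cases (m u); omega
    · have := hS u
      simp only [Finset.sum_neg_distrib]
      push_cast at this ⊢
      linarith
    · have := hM u
      simp only [Finset.sum_neg_distrib]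
      linarith
    · simp only [Finset.sum_neg_distrib]
      omega
end

section
/- For every ε > 0 there exist a malicious Bayesian congestion game Ψ with linear latency functions (f_e(x) = a_e·x with a_e > 0) and identical type probability p ∈ (0,1) for all players, and a pure Nash equilibrium s of the corresponding congestion game Γ_Ψ, such that for every mixed Bayesian Nash equilibrium Q of Ψ it holds that SC(Γ_Ψ, s) ≥ (5/2 − ε) · SC(Ψ, Q). -/
open Finset

namespace Game

variable {N E : Type} [Fintype N] [DecidableEq N] [Fintype E] [DecidableEq E]

/-- A pure strategy profile of the corresponding (non-malicious) congestion game `Γ_Ψ`. -/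
abbrev CProfile (N E : Type) := N → Finset E

/-- Validity for congestion-game profiles. -/
def CValid (G : Game N E) (s : CProfile N E) : Prop := ∀ u, s u ∈ G.S u

/-- Load (number of players) on resource `e`. -/
def load (s : CProfile N E) (e : E) : ℕ := (Finset.univ.filter fun u => e ∈ s u).card

/-- Private cost of player `u` in the congestion game `Γ_Ψ`. -/
noncomputable def CPC (G : Game N E) (s : CProfile N E) (u : N) : ℝ :=
  ∑ e ∈ s u, G.f e (load s e)

/-- Social cost (average latency) in the congestion game `Γ_Ψ`. -/
noncomputable def CSC (G : Game N E) (s : CProfile N E) : ℝ :=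
  (∑ e, (load s e : ℝ) * G.f e (load s e)) / (Fintype.card N : ℝ)

/-- Optimum social cost of the congestion game `Γ_Ψ`. -/
noncomputable def COpt (G : Game N E) : ℝ :=
  sInf {x | ∃ s : CProfile N E, G.CValid s ∧ G.CSC s = x}

/-- Pure Nash equilibrium of the congestion game `Γ_Ψ`. -/
def IsPureNE (G : Game N E) (s : CProfile N E) : Prop :=
  G.CValid s ∧ ∀ u : N, ∀ t ∈ G.S u, G.CPC s u ≤ G.CPC (Function.update s u t) u

end Game
/-- A mixed profile: for each player, probability weights for the selfish and malicious
type-agents over pure strategies. -/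
structure Mixed (N E : Type) where
  qs : N → Finset E → ℝ
  qm : N → Finset E → ℝ

namespace Game

variable {N E : Type} [Fintype N] [DecidableEq N] [Fintype E] [DecidableEq E]

/-- Validity of a mixed profile: each type-agent's weights form a probability
distribution supported on the player's strategy set. -/
def MixedValid (G : Game N E) (Q : Mixed N E) : Prop :=
  ∀ u, (∀ t, 0 ≤ Q.qs u t) ∧ (∀ t, 0 ≤ Q.qm u t) ∧
    (∀ t, Q.qs u t ≠ 0 → t ∈ G.S u) ∧ (∀ t, Q.qm u t ≠ 0 → t ∈ G.S u) ∧
    (∑ t, Q.qs u t) = 1 ∧ (∑ t, Q.qm u t) = 1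

/-- Probability that the (independent) mixed profile `Q` realizes the pure profile `σ`. -/
noncomputable def prob (Q : Mixed N E) (σ : Profile N E) : ℝ :=
  ∏ u, Q.qs u (σ u).1 * Q.qm u (σ u).2

/-- Expected private cost of player `u` under the mixed profile `Q`. -/
noncomputable def mPC (G : Game N E) (Q : Mixed N E) (u : N) : ℝ :=
  ∑ σ : Profile N E, prob Q σ * G.PC σ u

/-- Social cost of a mixed profile. -/
noncomputable def mSC (G : Game N E) (Q : Mixed N E) : ℝ :=
  (∑ u, (1 - G.p u) * G.mPC Q u) / ((Fintype.card N : ℝ) - ∑ u, G.p u)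

/-- The point mass distribution on the pure strategy `t`. -/
noncomputable def pointMass (t : Finset E) : Finset E → ℝ := fun s => if s = t then 1 else 0

/-- Replace the mixed strategy of the selfish type-agent of player `u` by the point mass on `t`. -/
noncomputable def updQS (Q : Mixed N E) (u : N) (t : Finset E) : Mixed N E :=
  ⟨Function.update Q.qs u (pointMass t), Q.qm⟩

/-- Replace the mixed strategy of the malicious type-agent of player `u` by the point mass on `t`. -/
noncomputable def updQM (Q : Mixed N E) (u : N) (t : Finset E) : Mixed N E :=
  ⟨Q.qs, Function.update Q.qm u (pointMass t)⟩

/-- Mixed Bayesian Nash equilibrium. -/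
def IsMixedBNE (G : Game N E) (Q : Mixed N E) : Prop :=
  G.MixedValid Q ∧ ∀ u : N, ∀ t ∈ G.S u,
    G.mPC Q u ≤ G.mPC (updQS Q u t) u ∧ G.mSC (updQM Q u t) ≤ G.mSC Q

end Game


namespace WM

open Game

section General
variable {N E : Type} [Fintype N] [DecidableEq N] [Fintype E] [DecidableEq E]

/-- Product formula for independent expectations. -/
lemma expect_prod (Q : Mixed N E) (F : N → Finset E × Finset E → ℝ) :
    ∑ σ : Profile N E, prob Q σ * ∏ k, F k (σ k)
      = ∏ k, ∑ x : Finset E × Finset E, Q.qs k x.1 * Q.qm k x.2 * F k x := by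
  rw [Finset.prod_univ_sum, Fintype.piFinset_univ]
  refine Finset.sum_congr rfl fun σ _ => ?_
  rw [prob, ← Finset.prod_mul_distrib]

lemma marg_one (G : Game N E) (Q : Mixed N E) (hQ : G.MixedValid Q) (k : N) :
    ∑ x : Finset E × Finset E, Q.qs k x.1 * Q.qm k x.2 = 1 := by
  rw [Fintype.sum_prod_type]
  simp only [← Finset.mul_sum]
  rw [(hQ k).2.2.2.2.2]
  simp [(hQ k).2.2.2.2.1]

lemma expect_one (G : Game N E) (Q : Mixed N E) (hQ : G.MixedValid Q) (u : N)
    (g : Finset E × Finset E → ℝ) :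
    ∑ σ : Profile N E, prob Q σ * g (σ u)
      = ∑ x : Finset E × Finset E, Q.qs u x.1 * Q.qm u x.2 * g x := by
  have h := expect_prod Q (fun k x => if k = u then g x else 1)
  have h1 : ∀ σ : Profile N E, (∏ k, if k = u then g (σ k) else 1) = g (σ u) := by
    intro σ
    rw [Fintype.prod_eq_single u]
    · simp
    · intro k hk; simp [hk]
  simp only [h1] at h
  rw [h, Fintype.prod_eq_single u]
  · simp
  · intro k hk; simp [hk, marg_one G Q hQ]

lemma expect_two (G : Game N E) (Q : Mixed N E) (hQ : G.MixedValid Q) (u v : N) (huv : v ≠ u)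
    (g h : Finset E × Finset E → ℝ) :
    ∑ σ : Profile N E, prob Q σ * (g (σ u) * h (σ v))
      = (∑ x : Finset E × Finset E, Q.qs u x.1 * Q.qm u x.2 * g x) *
        ∑ x : Finset E × Finset E, Q.qs v x.1 * Q.qm v x.2 * h x := by
  have H := expect_prod Q (fun k x => if k = u then g x else if k = v then h x else 1)
  have h1 : ∀ σ : Profile N E,
      (∏ k, if k = u then g (σ k) else if k = v then h (σ k) else 1) = g (σ u) * h (σ v) := by
    intro σ
    rw [Fintype.prod_eq_mul u v huv.symm]
    · simp [huv]
    · intro k hk; simp [hk.1, hk.2]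
  simp only [h1] at H
  rw [H, Fintype.prod_eq_mul u v huv.symm]
  · simp [huv]
  · intro k hk; simp [hk.1, hk.2, marg_one G Q hQ]

/-- Marginal probability that a distribution uses resource `e`. -/
noncomputable def mg (q : Finset E → ℝ) (e : E) : ℝ := ∑ t, q t * (if e ∈ t then 1 else 0)

lemma marg_s (G : Game N E) (Q : Mixed N E) (hQ : G.MixedValid Q) (u : N) (e : E) :
    ∑ x : Finset E × Finset E, Q.qs u x.1 * Q.qm u x.2 * (if e ∈ x.1 then 1 else 0)
      = mg (Q.qs u) e := by
  rw [Fintype.sum_prod_type, mg]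
  refine Finset.sum_congr rfl fun t _ => ?_
  by_cases h : e ∈ t
  · simp [h, ← Finset.mul_sum, (hQ u).2.2.2.2.2]
  · simp [h]

lemma marg_m (G : Game N E) (Q : Mixed N E) (hQ : G.MixedValid Q) (u : N) (e : E) :
    ∑ x : Finset E × Finset E, Q.qs u x.1 * Q.qm u x.2 * (if e ∈ x.2 then 1 else 0)
      = mg (Q.qm u) e := by
  rw [Fintype.sum_prod_type_right, mg]
  refine Finset.sum_congr rfl fun t _ => ?_
  by_cases h : e ∈ t
  · simp [h, ← Finset.sum_mul, (hQ u).2.2.2.2.1]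
  · simp [h]

lemma mPC_formula (G : Game N E) (p : ℝ) (hp : ∀ u, G.p u = p)
    (hf : ∀ e x, G.f e x = x) (Q : Mixed N E) (hQ : G.MixedValid Q) (u : N) :
    G.mPC Q u = ∑ e, mg (Q.qs u) e *
      (1 + ∑ v ∈ Finset.univ.erase u, ((1 - p) * mg (Q.qs v) e + p * mg (Q.qm v) e)) := by
  have key : ∀ σ : Profile N E, prob Q σ * G.PC σ u =
      ∑ e, (prob Q σ * (if e ∈ (σ u).1 then 1 else 0) +
        ∑ v ∈ Finset.univ.erase u,
          ((1 - p) * (prob Q σ * ((if e ∈ (σ u).1 then 1 else 0) * (if e ∈ (σ v).1 then 1 else 0)))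
          + p * (prob Q σ * ((if e ∈ (σ u).1 then 1 else 0) * (if e ∈ (σ v).2 then 1 else 0))))) := by
    intro σ
    have : G.PC σ u = ∑ e, (if e ∈ (σ u).1 then (1:ℝ) else 0) *
        (1 + ∑ v ∈ Finset.univ.erase u, ((1 - p) * (if e ∈ (σ v).1 then 1 else 0)
          + p * (if e ∈ (σ v).2 then 1 else 0))) := by
      simp only [PC, hf, selfLoadEx, malLoadEx, hp, ite_mul, one_mul, zero_mul]
      rw [← Finset.sum_filter]
      simp only [Finset.filter_univ_mem]
      refine Finset.sum_congr rfl fun e _ => ?_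
      rw [← Finset.sum_add_distrib, add_comm]
      simp
    rw [this, Finset.mul_sum]
    refine Finset.sum_congr rfl fun e _ => ?_
    rw [mul_add, mul_add, Finset.mul_sum, Finset.mul_sum, mul_one]
    congr 1
    refine Finset.sum_congr rfl fun v _ => ?_
    ring
  rw [mPC, Finset.sum_congr rfl fun σ _ => key σ, Finset.sum_comm]
  refine Finset.sum_congr rfl fun e _ => ?_
  rw [Finset.sum_add_distrib, Finset.sum_comm, mul_add, mul_one, Finset.mul_sum]
  congr 1
  · rw [expect_one G Q hQ u (fun x => if e ∈ x.1 then 1 else 0), marg_s G Q hQ]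
  · refine Finset.sum_congr rfl fun v hv => ?_
    have hv' : v ≠ u := (Finset.mem_erase.1 hv).1
    rw [Finset.sum_add_distrib, ← Finset.mul_sum, ← Finset.mul_sum,
      expect_two G Q hQ u v hv' (fun x => if e ∈ x.1 then 1 else 0)
        (fun x => if e ∈ x.1 then 1 else 0),
      expect_two G Q hQ u v hv' (fun x => if e ∈ x.1 then 1 else 0)
        (fun x => if e ∈ x.2 then 1 else 0),
      marg_s G Q hQ, marg_s G Q hQ, marg_m G Q hQ]
    ring

lemma mg_two (q : Finset E → ℝ) (A B : Finset E) (hAB : A ≠ B)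
    (hs : ∀ t, q t ≠ 0 → t = A ∨ t = B) (h1 : ∑ t, q t = 1) (e : E) :
    mg q e = q A * (if e ∈ A then 1 else 0) + (1 - q A) * (if e ∈ B then 1 else 0) := by
  have hz : ∀ t, t ≠ A ∧ t ≠ B → q t = 0 := by
    intro t ht
    by_contra h
    rcases hs t h with h | h
    · exact ht.1 h
    · exact ht.2 h
  have h2 : q A + q B = 1 := by
    rw [← h1, Fintype.sum_eq_add A B hAB hz]
  rw [mg, Fintype.sum_eq_add A B hAB (fun t ht => by rw [hz t ht, zero_mul]), ← h2]
  ring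

lemma valid_updQS (G : Game N E) (Q : Mixed N E) (hQ : G.MixedValid Q) (u : N) (t : Finset E)
    (ht : t ∈ G.S u) : G.MixedValid (updQS Q u t) := by
  intro v
  obtain ⟨a, b, c, d, e, f⟩ := hQ v
  by_cases h : v = u
  · subst h
    refine ⟨?_, b, ?_, d, ?_, f⟩
    · intro s; simp only [updQS, Function.update_self, pointMass]; split_ifs <;> norm_num
    · intro s; simp only [updQS, Function.update_self, pointMass]; split_ifs with h
      · intro _; rw [h]; exact ht
      · simp
    · simp [updQS, pointMass]
  · simpa [updQS, h] using And.intro a ⟨b, c, d, e, f⟩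

lemma valid_updQM (G : Game N E) (Q : Mixed N E) (hQ : G.MixedValid Q) (u : N) (t : Finset E)
    (ht : t ∈ G.S u) : G.MixedValid (updQM Q u t) := by
  intro v
  obtain ⟨a, b, c, d, e, f⟩ := hQ v
  by_cases h : v = u
  · subst h
    refine ⟨a, ?_, c, ?_, e, ?_⟩
    · intro s; simp only [updQM, Function.update_self, pointMass]; split_ifs <;> norm_num
    · intro s; simp only [updQM, Function.update_self, pointMass]; split_ifs with h
      · intro _; rw [h]; exact ht
      · simp
    · simp [updQM, pointMass]
  · simpa [updQM, h] using And.intro a ⟨b, c, d, e, f⟩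

end General

/-- The bad strategies. -/
def Bd : Fin 3 → Finset (Fin 6) := ![{4, 1, 2}, {5, 0, 2}, {3, 0, 1}]

/-- The good strategies. -/
def Gd : Fin 3 → Finset (Fin 6) := ![{0, 3}, {1, 4}, {2, 5}]

/-- The game witnessing the lower bound. -/
noncomputable def Gm (p : ℝ) : Game (Fin 3) (Fin 6) where
  S := fun u => {Bd u, Gd u}
  p := fun _ => p
  f := fun _ x => x

lemma Bd_ne (u : Fin 3) : Bd u ≠ Gd u := by revert u; decide

lemma mgs (p : ℝ) (Q : Mixed (Fin 3) (Fin 6)) (hQ : (Gm p).MixedValid Q) (u : Fin 3) (e : Fin 6) :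
    mg (Q.qs u) e = Q.qs u (Bd u) * (if e ∈ Bd u then 1 else 0)
      + (1 - Q.qs u (Bd u)) * (if e ∈ Gd u then 1 else 0) :=
  mg_two _ _ _ (Bd_ne u) (fun t h => by simpa [Gm] using (hQ u).2.2.1 t h) (hQ u).2.2.2.2.1 e

lemma mgm (p : ℝ) (Q : Mixed (Fin 3) (Fin 6)) (hQ : (Gm p).MixedValid Q) (u : Fin 3) (e : Fin 6) :
    mg (Q.qm u) e = Q.qm u (Bd u) * (if e ∈ Bd u then 1 else 0)
      + (1 - Q.qm u (Bd u)) * (if e ∈ Gd u then 1 else 0) :=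
  mg_two _ _ _ (Bd_ne u) (fun t h => by simpa [Gm] using (hQ u).2.2.2.1 t h) (hQ u).2.2.2.2.2 e

/-- Expected use of the bad strategy. -/
noncomputable def xx (p : ℝ) (Q : Mixed (Fin 3) (Fin 6)) (u : Fin 3) : ℝ :=
  (1 - p) * Q.qs u (Bd u) + p * Q.qm u (Bd u)

lemma pc_eq (p : ℝ) (Q : Mixed (Fin 3) (Fin 6)) (hQ : (Gm p).MixedValid Q) (u : Fin 3) :
    (Gm p).mPC Q u = Q.qs u (Bd u) * (6 - xx p Q (u + 1))
      + (1 - Q.qs u (Bd u)) * (2 + xx p Q (u + 1) + 2 * xx p Q (u + 2)) := by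
  rw [mPC_formula (Gm p) p (fun _ => rfl) (fun _ _ => rfl) Q hQ u]
  simp only [mgs p Q hQ, mgm p Q hQ]
  have e0 : (Finset.univ.erase (0 : Fin 3)) = {1, 2} := by decide
  have e1 : (Finset.univ.erase (1 : Fin 3)) = {2, 0} := by decide
  have e2 : (Finset.univ.erase (2 : Fin 3)) = {0, 1} := by decide
  have a1 : (1 : Fin 3) + 1 = 2 := by decide
  have a2 : (1 : Fin 3) + 2 = 0 := by decide
  have a3 : (2 : Fin 3) + 1 = 0 := by decide
  have a4 : (2 : Fin 3) + 2 = 1 := by decide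
  have cases3 : u = 0 ∨ u = 1 ∨ u = 2 := by revert u; decide
  have B0 : ∀ e, (e ∈ Bd 0) = (e = 4 ∨ e = 1 ∨ e = 2) := by intro e; simp [Bd]
  have B1 : ∀ e, (e ∈ Bd 1) = (e = 5 ∨ e = 0 ∨ e = 2) := by intro e; simp [Bd]
  have B2 : ∀ e, (e ∈ Bd 2) = (e = 3 ∨ e = 0 ∨ e = 1) := by intro e; simp [Bd]
  have G0 : ∀ e, (e ∈ Gd 0) = (e = 0 ∨ e = 3) := by intro e; simp [Gd]
  have G1 : ∀ e, (e ∈ Gd 1) = (e = 1 ∨ e = 4) := by intro e; simp [Gd]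
  have G2 : ∀ e, (e ∈ Gd 2) = (e = 2 ∨ e = 5) := by intro e; simp [Gd]
  rcases cases3 with rfl | rfl | rfl
  · rw [e0]
    simp only [zero_add, xx, Fin.sum_univ_six, Finset.sum_pair (show (1 : Fin 3) ≠ 2 by decide),
      B0, B1, B2, G0, G1, G2]
    simp +decide only [if_true, if_false]
    ring
  · rw [e1, a1, a2]
    simp only [xx, Fin.sum_univ_six, Finset.sum_pair (show (2 : Fin 3) ≠ 0 by decide),
      B0, B1, B2, G0, G1, G2]
    simp +decide only [if_true, if_false]
    ring
  · rw [e2, a3, a4]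
    simp only [xx, Fin.sum_univ_six, Finset.sum_pair (show (0 : Fin 3) ≠ 1 by decide),
      B0, B1, B2, G0, G1, G2]
    simp +decide only [if_true, if_false]
    ring

lemma sc_eq (p : ℝ) (hp : p < 1) (Q : Mixed (Fin 3) (Fin 6)) :
    (Gm p).mSC Q = ((Gm p).mPC Q 0 + (Gm p).mPC Q 1 + (Gm p).mPC Q 2) / 3 := by
  have : (1 - p) ≠ 0 := by linarith
  have h3 : (3 : ℝ) - 3 * p ≠ 0 := by intro h; apply this; linarith
  have hp' : ∀ u, (Gm p).p u = p := fun _ => rfl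
  simp only [mSC, hp', Fin.sum_univ_three, Fintype.card_fin]
  push_cast
  rw [div_eq_div_iff (by intro h; apply h3; linarith) (by norm_num)]
  ring

lemma le_one (p : ℝ) (Q : Mixed (Fin 3) (Fin 6)) (hQ : (Gm p).MixedValid Q) (u : Fin 3) :
    Q.qs u (Bd u) ≤ 1 ∧ Q.qm u (Bd u) ≤ 1 := by
  obtain ⟨a, b, _, _, e, f⟩ := hQ u
  constructor
  · rw [← e]; exact Finset.single_le_sum (fun t _ => a t) (Finset.mem_univ _)
  · rw [← f]; exact Finset.single_le_sum (fun t _ => b t) (Finset.mem_univ _)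

lemma selfish (p : ℝ) (Q : Mixed (Fin 3) (Fin 6)) (hQ : (Gm p).IsMixedBNE Q) (u : Fin 3) :
    Q.qs u (Bd u) * (2 - xx p Q (u + 1) - xx p Q (u + 2)) ≤ 0 := by
  have hG : Gd u ∈ (Gm p).S u := by simp [Gm]
  have h := (hQ.2 u (Gd u) hG).1
  rw [pc_eq p Q hQ.1, pc_eq p _ (valid_updQS _ Q hQ.1 u _ hG)] at h
  have n1 : u + 1 ≠ u := (by decide : ∀ u : Fin 3, u + 1 ≠ u) u
  have n2 : u + 2 ≠ u := (by decide : ∀ u : Fin 3, u + 2 ≠ u) u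
  simp only [xx, updQS, Function.update_self, Function.update_of_ne n1, Function.update_of_ne n2,
    pointMass, if_neg (Bd_ne u)] at h
  simp only [xx]
  linarith

lemma not_all (p : ℝ) (h0 : 0 < p) (h1 : p < 1) (Q : Mixed (Fin 3) (Fin 6))
    (hQ : (Gm p).IsMixedBNE Q)
    (hs : ∀ u, Q.qs u (Bd u) = 1) (hm : ∀ u, Q.qm u (Bd u) = 1) : False := by
  have hG : Gd 0 ∈ (Gm p).S 0 := by simp [Gm]
  have h := (hQ.2 0 (Gd 0) hG).2
  have hv := valid_updQM _ Q hQ.1 0 _ hG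
  have a1 : (1 : Fin 3) + 1 = 2 := by decide
  have a2 : (1 : Fin 3) + 2 = 0 := by decide
  have a3 : (2 : Fin 3) + 1 = 0 := by decide
  have a4 : (2 : Fin 3) + 2 = 1 := by decide
  rw [sc_eq p h1, sc_eq p h1] at h
  simp only [pc_eq p _ hv, pc_eq p Q hQ.1, a1, a2, a3, a4, zero_add] at h
  simp only [xx, updQM, Function.update_self,
    Function.update_of_ne (show (1 : Fin 3) ≠ 0 by decide),
    Function.update_of_ne (show (2 : Fin 3) ≠ 0 by decide),
    pointMass, if_neg (Bd_ne 0), hs, hm] at h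
  linarith

lemma eq_one_of (p b m : ℝ) (h0 : 0 < p) (h1 : p < 1) (hb : b ≤ 1) (hm : m ≤ 1)
    (h : 1 ≤ (1 - p) * b + p * m) : b = 1 ∧ m = 1 := by
  constructor
  · apply le_antisymm hb
    by_contra hc
    push Not at hc
    nlinarith [mul_pos (sub_pos.2 h1) (sub_pos.2 hc), mul_nonneg h0.le (sub_nonneg.2 hm)]
  · apply le_antisymm hm
    by_contra hc
    push Not at hc
    nlinarith [mul_pos h0 (sub_pos.2 hc), mul_nonneg (sub_pos.2 h1).le (sub_nonneg.2 hb)]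

lemma xx_le (p : ℝ) (h0 : 0 < p) (h1 : p < 1) (Q : Mixed (Fin 3) (Fin 6))
    (hQ : (Gm p).MixedValid Q) (u : Fin 3) : xx p Q u ≤ 1 := by
  obtain ⟨a, b⟩ := le_one p Q hQ u
  unfold xx
  nlinarith [mul_nonneg h0.le (sub_nonneg.2 b), mul_nonneg (sub_pos.2 h1).le (sub_nonneg.2 a)]

lemma all_good (p : ℝ) (h0 : 0 < p) (h1 : p < 1) (Q : Mixed (Fin 3) (Fin 6))
    (hQ : (Gm p).IsMixedBNE Q) (u : Fin 3) : Q.qs u (Bd u) = 0 := by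
  -- a positive weight on the bad strategy forces the two other players to be fully bad
  have step : ∀ v, 0 < Q.qs v (Bd v) →
      (Q.qs (v + 1) (Bd (v + 1)) = 1 ∧ Q.qm (v + 1) (Bd (v + 1)) = 1) ∧
      (Q.qs (v + 2) (Bd (v + 2)) = 1 ∧ Q.qm (v + 2) (Bd (v + 2)) = 1) := by
    intro v hv
    have h := nonpos_of_mul_nonpos_right (selfish p Q hQ v) hv
    have l1 := xx_le p h0 h1 Q hQ.1 (v + 1)
    have l2 := xx_le p h0 h1 Q hQ.1 (v + 2)
    have c1 := le_one p Q hQ.1 (v + 1)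
    have c2 := le_one p Q hQ.1 (v + 2)
    refine ⟨eq_one_of p _ _ h0 h1 c1.1 c1.2 ?_, eq_one_of p _ _ h0 h1 c2.1 c2.2 ?_⟩
    · change 1 ≤ xx p Q (v + 1); linarith
    · change 1 ≤ xx p Q (v + 2); linarith
  by_contra hne
  have hpos : 0 < Q.qs u (Bd u) := lt_of_le_of_ne ((hQ.1 u).1 _) (Ne.symm hne)
  have s1 := step u hpos
  have s2 := step (u + 1) (by rw [s1.1.1]; norm_num)
  have e : u + 1 + 2 = u := (by decide : ∀ u : Fin 3, u + 1 + 2 = u) u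
  rw [e] at s2
  have all : ∀ v, Q.qs v (Bd v) = 1 ∧ Q.qm v (Bd v) = 1 := by
    intro v
    have hv : v = u ∨ v = u + 1 ∨ v = u + 2 :=
      (by decide : ∀ u v : Fin 3, v = u ∨ v = u + 1 ∨ v = u + 2) u v
    rcases hv with rfl | rfl | rfl
    · exact s2.2
    · exact s1.1
    · exact s1.2
  exact not_all p h0 h1 Q hQ (fun v => (all v).1) (fun v => (all v).2)

lemma sc_bound (p : ℝ) (h0 : 0 < p) (h1 : p < 1) (Q : Mixed (Fin 3) (Fin 6))
    (hQ : (Gm p).IsMixedBNE Q) : 0 ≤ (Gm p).mSC Q ∧ (Gm p).mSC Q ≤ 2 + 3 * p := by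
  have hx : ∀ u, 0 ≤ xx p Q u ∧ xx p Q u ≤ p := by
    intro u
    have := (le_one p Q hQ.1 u).2
    have h' := (hQ.1 u).2.1 (Bd u)
    unfold xx
    rw [all_good p h0 h1 Q hQ u]
    constructor
    · have := mul_nonneg h0.le h'
      linarith
    · nlinarith
  have hpc : ∀ u, 0 ≤ (Gm p).mPC Q u ∧ (Gm p).mPC Q u ≤ 2 + 3 * p := by
    intro u
    rw [pc_eq p Q hQ.1, all_good p h0 h1 Q hQ u]
    have b1 := hx (u + 1)
    have b2 := hx (u + 2)
    constructor <;> linarith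
  rw [sc_eq p h1]
  have := hpc 0
  have := hpc 1
  have := hpc 2
  constructor <;> linarith

lemma load_Bd (e : Fin 6) : load Bd e = if e < 3 then 2 else 1 := by revert e; decide

lemma nat_cost : ∀ u : Fin 3, ∑ e ∈ Bd u, load Bd e = 5 := by decide

lemma nat_dev : ∀ u : Fin 3, ∑ e ∈ Gd u, load (Function.update Bd u (Gd u)) e = 5 := by decide

lemma nat_tot : ∑ e, load Bd e * load Bd e = 15 := by decide

lemma isNE (p : ℝ) : (Gm p).IsPureNE Bd := by
  refine ⟨fun u => by simp [Gm], ?_⟩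
  intro u t ht
  have ht' : t = Bd u ∨ t = Gd u := by simpa [Gm] using ht
  rcases ht' with rfl | rfl
  · simp
  · have hf : ∀ e x, (Gm p).f e x = x := fun _ _ => rfl
    simp only [CPC, hf, Function.update_self]
    rw [← Nat.cast_sum, ← Nat.cast_sum, nat_cost, nat_dev]

lemma csc (p : ℝ) : (Gm p).CSC Bd = 5 := by
  have hf : ∀ e x, (Gm p).f e x = x := fun _ _ => rfl
  have h : ((∑ e, load Bd e * load Bd e : ℕ) : ℝ) = 15 := by rw [nat_tot]; norm_num
  push_cast at h
  simp only [CSC, hf, Fintype.card_fin]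
  rw [h]; norm_num

end WM

theorem windfall_of_malice_lower_bound (ε : ℝ) (hε : 0 < ε) :
    ∃ (n r : ℕ) (p : ℝ) (G : Game (Fin n) (Fin r)) (a : Fin r → ℝ),
      2 ≤ n ∧ 2 ≤ r ∧ 0 < p ∧ p < 1 ∧
      -- identical type probabilities
      (∀ u, G.p u = p) ∧
      -- linear latency functions with positive slopes
      (∀ e, 0 < a e) ∧ (∀ e x, G.f e x = a e * x) ∧
      -- strategy sets are nonempty sets of nonempty sets of resources
      (∀ u, (G.S u).Nonempty) ∧ (∀ u, ∀ t ∈ G.S u, t.Nonempty) ∧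
      ∃ s : Game.CProfile (Fin n) (Fin r),
        G.IsPureNE s ∧
        ∀ Q : Mixed (Fin n) (Fin r),
          G.IsMixedBNE Q → (5 / 2 - ε) * G.mSC Q ≤ G.CSC s := by
  have h0 : 0 < min (ε / 5) (1 / 2) := by positivity
  have h1 : min (ε / 5) (1 / 2) < 1 := lt_of_le_of_lt (min_le_right _ _) (by norm_num)
  have h2 : min (ε / 5) (1 / 2) ≤ ε / 5 := min_le_left _ _
  generalize min (ε / 5) (1 / 2) = p at h0 h1 h2
  refine ⟨3, 6, p, WM.Gm p, fun _ => 1, by norm_num, by norm_num, h0, h1, fun _ => rfl,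
    fun _ => one_pos, fun _ x => (one_mul x).symm, fun u => ⟨WM.Bd u, by simp [WM.Gm]⟩, ?_,
    WM.Bd, WM.isNE p, ?_⟩
  · intro u t ht
    have ht' : t = WM.Bd u ∨ t = WM.Gd u := by simpa [WM.Gm] using ht
    rcases ht' with rfl | rfl
    · exact (by decide : ∀ u, (WM.Bd u).Nonempty) u
    · exact (by decide : ∀ u, (WM.Gd u).Nonempty) u
  · intro Q hQ
    obtain ⟨a, b⟩ := WM.sc_bound p h0 h1 Q hQ
    rw [WM.csc]
    by_cases hc : 5 / 2 - ε ≤ 0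
    · exact (mul_nonpos_of_nonpos_of_nonneg hc a).trans (by norm_num)
    · push Not at hc
      calc (5 / 2 - ε) * (WM.Gm p).mSC Q ≤ (5 / 2 - ε) * (2 + 3 * p) :=
            mul_le_mul_of_nonneg_left b hc.le
        _ ≤ 5 := by nlinarith [mul_pos hε h0]
end
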